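/- arXiv:1503.02627 — 2 statements merged into one kernel-verified Lean document; each statement's English description precedes it below -/
import Mathlib

section
/- Let A be a finite type equipped with binary operations ⋆ and ⊓, unary operations d, r, fix, and constants z and e. If there exist a type X and a representation of (A, ⋆, ⊓, d, r, fix, z, e) by partial functions on X, then there exist a finite type Y and such a representation on Y. (The finite representation property for the signature {composition, intersection, domain, range, zero, identity, fixset}.) -/
universe u v w

/-- A set of pairs is functional (is a partial function). -/
def Functional {X : Type u} (f : Set (X × X)) : Prop :=
  ∀ x y y' : X, (x, y) ∈ f → (x, y') ∈ f → y = y'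

/-- Composition of partial functions (left-to-right). -/
def pComp {X : Type u} (f g : Set (X × X)) : Set (X × X) :=
  {p | ∃ y, (p.1, y) ∈ f ∧ (y, p.2) ∈ g}

/-- Diagonal of the domain. -/
def pDom {X : Type u} (f : Set (X × X)) : Set (X × X) :=
  {p | p.1 = p.2 ∧ ∃ y, (p.1, y) ∈ f}

/-- Diagonal of the range. -/
def pRan {X : Type u} (f : Set (X × X)) : Set (X × X) :=
  {p | p.1 = p.2 ∧ ∃ x, (x, p.2) ∈ f}

/-- The identity function on `X`. -/
def pId (X : Type u) : Set (X × X) := {p | p.1 = p.2}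

/-- Diagonal of the antidomain. -/
def pAnti {X : Type u} (f : Set (X × X)) : Set (X × X) :=
  {p | p.1 = p.2 ∧ ¬∃ y, (p.1, y) ∈ f}

/-- Fixset: diagonal of the fixed points. -/
def pFix {X : Type u} (f : Set (X × X)) : Set (X × X) :=
  {p | p.1 = p.2 ∧ (p.1, p.1) ∈ f}

/-- Preferential union. -/
def pPref {X : Type u} (f g : Set (X × X)) : Set (X × X) :=
  f ∪ {p | p ∈ g ∧ ¬∃ z, (p.1, z) ∈ f}

/-- Iterated composition: `pPow f 0 = pId X`, `pPow f (n+1) = f ∘ pPow f n`. -/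
def pPow {X : Type u} (f : Set (X × X)) : ℕ → Set (X × X)
  | 0 => pId X
  | n + 1 => pComp f (pPow f n)

/-- Maximum iterate. -/
def pMaxIter {X : Type u} (f : Set (X × X)) : Set (X × X) :=
  ⋃ n : ℕ, pComp (pPow f n) (pAnti f)

/-- Opposite (bilateral inverse). -/
def pOpp {X : Type u} (f : Set (X × X)) : Set (X × X) :=
  {p | (p.2, p.1) ∈ f ∧ ∀ x', (x', p.1) ∈ f → x' = p.2}

/-- Unique-preimage operation. -/
def pU {X : Type u} (f : Set (X × X)) : Set (X × X) :=
  {p | p.1 = p.2 ∧ ∃! x, (x, p.2) ∈ f}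

/-- The future of a vertex `x` with respect to `θ`. -/
def future {A : Type*} {X : Type u} (θ : A → Set (X × X)) (x : X) : Set X :=
  {y | ∃ b : A, (x, y) ∈ θ b}

/-- The present of a vertex `x` with respect to `θ`. -/
def present {A : Type*} {X : Type u} (θ : A → Set (X × X)) (x : X) : Set X :=
  {y | y ∈ future θ x ∧ x ∈ future θ y}

/-- `a` labels the edge `(x, y)`: `a` holds there and is least among elements holding there. -/
def Labels {A : Type*} {X : Type u} (meet : A → A → A) (θ : A → Set (X × X))
    (a : A) (x y : X) : Prop :=
  (x, y) ∈ θ a ∧ ∀ b : A, (x, y) ∈ θ b → meet a b = a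

/-- Representation for the signature {composition, intersection, domain, range, zero,
identity, fixset}. -/
def IsRepFixZE {A : Type*} {X : Type u} (star meet : A → A → A) (d r fix : A → A)
    (z e : A) (θ : A → Set (X × X)) : Prop :=
  Function.Injective θ ∧ (∀ a, Functional (θ a)) ∧
  (∀ a b, θ (star a b) = pComp (θ a) (θ b)) ∧
  (∀ a b, θ (meet a b) = θ a ∩ θ b) ∧
  (∀ a, θ (d a) = pDom (θ a)) ∧
  (∀ a, θ (r a) = pRan (θ a)) ∧
  (∀ a, θ (fix a) = pFix (θ a)) ∧
  θ z = (∅ : Set (X × X)) ∧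
  θ e = pId X

/-- A partial injective map on `S ⊆ T` into a finite type `A` with at least as many elements
as `T` extends to a map that is injective on `T`. -/
theorem Set.InjOn.exists_extend_of_embedding {A : Type*} {X : Type u} [Finite A] [Nonempty A]
    {S T : Set X} {c : X → A} (hc : Set.InjOn c S) (hST : S ⊆ T) (l : T ↪ A) :
    ∃ c' : X → A, Set.InjOn c' T ∧ Set.EqOn c c' S := by
  classical
  have := Fintype.ofFinite A
  have := Fintype.ofInjective l l.injective
  have hsub : (Finset.univ.filter fun t : T => (t : X) ∈ S).image (fun t : T => c t) ⊆
      Finset.univ := Finset.subset_univ _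
  obtain ⟨t, hst, -, ht⟩ := Finset.exists_subsuperset_card_eq hsub
    (Finset.card_image_le.trans (Finset.card_le_univ _))
    (Fintype.card_le_of_injective l l.injective : Fintype.card T ≤ (Finset.univ : Finset A).card)
  obtain ⟨g, hg⟩ := Finset.exists_equiv_extend_of_card_eq ht.symm hst
    (fun x hx y hy h => Subtype.ext (hc (by simpa using hx) (by simpa using hy) h))
  refine ⟨fun x => if hx : x ∈ T then g ⟨x, hx⟩ else Classical.arbitrary A, ?_, ?_⟩
  · intro x hx y hy h
    simp only [hx, hy, dif_pos] at h
    exact congrArg Subtype.val (g.injective (Subtype.ext h))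
  · intro x hx
    simp only [hST hx, dif_pos]
    exact (hg ⟨x, hST hx⟩ (by simpa using hx)).symm

section Codes

variable {A : Type*} {X : Type u} {star meet : A → A → A} {d r fix : A → A} {z e : A}
  {θ : A → Set (X × X)}

/-- Transport of a representation along a bijection of bases. -/
theorem IsRepFixZE.transport {Y : Type v} (h : IsRepFixZE star meet d r fix z e θ) (f : Y ≃ X) :
    IsRepFixZE star meet d r fix z e fun a => Prod.map f f ⁻¹' θ a := by
  obtain ⟨hinj, hfun, hstar, hmeet, hd, hr, hfix, hz, he⟩ := h
  refine ⟨fun a b hab => hinj ((f.surjective.prodMap f.surjective).preimage_injective hab),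
    fun a x y y' h h' => f.injective (hfun a _ _ _ h h'), fun a b => ?_, fun a b => ?_, fun a => ?_,
    fun a => ?_, fun a => ?_, ?_, ?_⟩
  all_goals ext ⟨x, y⟩
  · simp [hstar, pComp, f.surjective.exists]
  · simp [hmeet]
  · simp [hd, pDom, f.surjective.exists]
  · simp [hr, pRan, f.surjective.exists]
  · simp [hfix, pFix]
  · simp [hz]
  · simp [he, pId]

/-- The future of a vertex embeds in the algebra. -/
theorem IsRepFixZE.nonempty_future_embedding (h : IsRepFixZE star meet d r fix z e θ) (x : X) :
    Nonempty (future θ x ↪ A) := by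
  choose l hl using fun y : future θ x => y.2
  exact ⟨l, fun y y' hy => Subtype.ext (h.2.1 _ _ _ _ (hl y) (hy ▸ hl y'))⟩

theorem IsRepFixZE.future_subset (h : IsRepFixZE star meet d r fix z e θ) {a : A} {x y : X}
    (hxy : (x, y) ∈ θ a) : future θ y ⊆ future θ x := by
  rintro w ⟨b, hb⟩
  exact ⟨star a b, by rw [h.2.2.1]; exact ⟨y, hxy, hb⟩⟩

theorem IsRepFixZE.mem_e (h : IsRepFixZE star meet d r fix z e θ) {x y : X} :
    (x, y) ∈ θ e ↔ x = y := by
  rw [h.2.2.2.2.2.2.2.2]; rfl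

/-- The isomorphism type of the future of `x`, with vertices coloured by `c`: the pairs `(a, k)`
such that the image of `x` under `a` has colour `k`. -/
def code (θ : A → Set (X × X)) (c : X → A) (x : X) : Set (A × A) :=
  {p | ∃ y, (x, y) ∈ θ p.1 ∧ c y = p.2}

theorem IsRepFixZE.mem_code_iff (h : IsRepFixZE star meet d r fix z e θ) {c : X → A} {a : A}
    {x y : X} (hxy : (x, y) ∈ θ a) {b k : A} :
    (b, k) ∈ code θ c y ↔ (star a b, k) ∈ code θ c x := by
  constructor
  · rintro ⟨w, hw, hk⟩
    exact ⟨w, by rw [h.2.2.1]; exact ⟨y, hxy, hw⟩, hk⟩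
  · rintro ⟨w, hw, hk⟩
    rw [h.2.2.1] at hw
    obtain ⟨y', hy', hw⟩ := hw
    obtain rfl := h.2.1 _ _ _ _ hxy hy'
    exact ⟨w, hw, hk⟩

theorem IsRepFixZE.code_injOn (h : IsRepFixZE star meet d r fix z e θ) {c : X → A} {x : X}
    (hc : Set.InjOn c (future θ x)) : Set.InjOn (code θ c) (future θ x) := by
  intro y hy y' hy' hyy
  have : (e, c y) ∈ code θ c y := ⟨y, h.mem_e.2 rfl, rfl⟩
  rw [hyy] at this
  obtain ⟨w, hw, hk⟩ := this
  obtain rfl := h.mem_e.1 hw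
  exact hc hy hy' hk.symm

/-- Equally coded vertices have equally coded images. -/
theorem IsRepFixZE.exists_code_eq (h : IsRepFixZE star meet d r fix z e θ) {c c' : X → A} {a : A}
    {x x' y : X} (hxx : code θ c x = code θ c' x') (hxy : (x, y) ∈ θ a) :
    ∃ y', (x', y') ∈ θ a ∧ code θ c y = code θ c' y' := by
  have : (a, c y) ∈ code θ c x := ⟨y, hxy, rfl⟩
  rw [hxx] at this
  obtain ⟨y', hy', -⟩ := this
  refine ⟨y', hy', ?_⟩
  ext ⟨b, k⟩
  rw [h.mem_code_iff hxy, h.mem_code_iff hy', hxx]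

/-- The codes of vertices whose futures are injectively coloured. -/
abbrev Codes (θ : A → Set (X × X)) : Type _ :=
  {s : Set (A × A) // ∃ x c, Set.InjOn c (future θ x) ∧ s = code θ c x}

/-- The edges on `Codes θ` induced by those on `X`. -/
def codeRep (θ : A → Set (X × X)) (a : A) : Set (Codes θ × Codes θ) :=
  {p | ∃ x y c, Set.InjOn c (future θ x) ∧ (x, y) ∈ θ a ∧ p.1.1 = code θ c x ∧ p.2.1 = code θ c y}

theorem IsRepFixZE.mem_codeRep_iff (h : IsRepFixZE star meet d r fix z e θ) {c : X → A} {a : A}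
    {x : X} {s t : Codes θ} (hc : Set.InjOn c (future θ x)) (hs : s.1 = code θ c x) :
    (s, t) ∈ codeRep θ a ↔ ∃ y, (x, y) ∈ θ a ∧ t.1 = code θ c y := by
  constructor
  · rintro ⟨x', y', c', -, hxy, hs', ht⟩
    obtain ⟨y, hy, hyy⟩ := h.exists_code_eq (hs'.symm.trans hs) hxy
    exact ⟨y, hy, ht.trans hyy⟩
  · rintro ⟨y, hy, ht⟩
    exact ⟨x, y, c, hc, hy, hs, ht⟩

theorem IsRepFixZE.isRep_codeRep [Finite A] (h : IsRepFixZE star meet d r fix z e θ) :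
    IsRepFixZE star meet d r fix z e (codeRep θ) := by
  have : Nonempty A := ⟨z⟩
  obtain ⟨hinj, hfun, hstar, hmeet, hd, hr, hfix, hz, -⟩ := id h
  have hrefl (x : X) : x ∈ future θ x := ⟨e, h.mem_e.2 rfl⟩
  refine ⟨?_, ?_, fun a b => ?_, fun a b => ?_, fun a => ?_, fun a => ?_, fun a => ?_, ?_, ?_⟩
  · have key (a b : A) (hab : codeRep θ a = codeRep θ b) : θ a ⊆ θ b := by
      rintro ⟨x, y⟩ hxy
      obtain ⟨l⟩ := h.nonempty_future_embedding x
      obtain ⟨c, hc, -⟩ := (Set.injOn_empty (fun _ : X => z)).exists_extend_of_embedding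
        (Set.empty_subset _) l
      have hmem : ((⟨_, x, c, hc, rfl⟩, ⟨_, y, c, hc.mono (h.future_subset hxy), rfl⟩) :
          Codes θ × Codes θ) ∈ codeRep θ b :=
        hab ▸ (h.mem_codeRep_iff hc rfl).2 ⟨y, hxy, rfl⟩
      obtain ⟨y', hy', hyy⟩ := (h.mem_codeRep_iff hc rfl).1 hmem
      obtain rfl := h.code_injOn hc ⟨a, hxy⟩ ⟨b, hy'⟩ hyy
      exact hy'
    exact fun a b hab => hinj ((key a b hab).antisymm (key b a hab.symm))
  · rintro a ⟨s, x, c, hc, rfl⟩ t t' ht ht'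
    rw [h.mem_codeRep_iff hc rfl] at ht ht'
    obtain ⟨y, hy, ht⟩ := ht
    obtain ⟨y', hy', ht'⟩ := ht'
    obtain rfl := hfun _ _ _ _ hy hy'
    exact Subtype.ext (ht.trans ht'.symm)
  all_goals
    ext ⟨⟨s, x, c, hc, rfl⟩, t⟩
    try rw [h.mem_codeRep_iff hc rfl]
  · simp only [hstar]
    constructor
    · rintro ⟨w, ⟨y, hy, hw⟩, ht⟩
      have hcy := hc.mono (h.future_subset hy)
      exact ⟨⟨_, y, c, hcy, rfl⟩, (h.mem_codeRep_iff hc rfl).2 ⟨y, hy, rfl⟩,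
        (h.mem_codeRep_iff hcy rfl).2 ⟨w, hw, ht⟩⟩
    · rintro ⟨q, hq, hqt⟩
      obtain ⟨y, hy, hq⟩ := (h.mem_codeRep_iff hc rfl).1 hq
      obtain ⟨w, hw, ht⟩ := (h.mem_codeRep_iff (hc.mono (h.future_subset hy)) hq).1 hqt
      exact ⟨w, ⟨y, hy, hw⟩, ht⟩
  · rw [Set.mem_inter_iff, h.mem_codeRep_iff hc rfl, h.mem_codeRep_iff hc rfl, hmeet]
    constructor
    · rintro ⟨y, ⟨ha, hb⟩, ht⟩
      exact ⟨⟨y, ha, ht⟩, ⟨y, hb, ht⟩⟩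
    · rintro ⟨⟨y, ha, ht⟩, ⟨y', hb, ht'⟩⟩
      obtain rfl := h.code_injOn hc ⟨a, ha⟩ ⟨b, hb⟩ (ht.symm.trans ht')
      exact ⟨y, ⟨ha, hb⟩, ht⟩
  · simp only [hd, pDom, Set.mem_ofPred_eq]
    constructor
    · rintro ⟨_, ⟨rfl, y, hy⟩, ht⟩
      exact ⟨Subtype.ext ht.symm, ⟨_, y, c, hc.mono (h.future_subset hy), rfl⟩,
        (h.mem_codeRep_iff hc rfl).2 ⟨y, hy, rfl⟩⟩
    · rintro ⟨ht, q, hq⟩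
      obtain ⟨y, hy, -⟩ := (h.mem_codeRep_iff hc rfl).1 hq
      exact ⟨x, ⟨rfl, y, hy⟩, (congrArg Subtype.val ht).symm⟩
  · simp only [hr, pRan, Set.mem_ofPred_eq]
    constructor
    · rintro ⟨_, ⟨rfl, w, hw⟩, ht⟩
      obtain ⟨l⟩ := h.nonempty_future_embedding w
      obtain ⟨c', hc', hcc⟩ := hc.exists_extend_of_embedding (h.future_subset hw) l
      refine ⟨Subtype.ext ht.symm, ⟨_, w, c', hc', rfl⟩,
        (h.mem_codeRep_iff hc' rfl).2 ⟨x, hw, ht.trans ?_⟩⟩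
      ext ⟨b, k⟩
      exact exists_congr fun y => and_congr_right fun hy => by rw [hcc ⟨b, hy⟩]
    · rintro ⟨ht, ⟨s, w, c', hc', rfl⟩, hq⟩
      obtain ⟨y, hy, hty⟩ := (h.mem_codeRep_iff hc' rfl).1 hq
      have hyr : (y, y) ∈ θ (r a) := by rw [hr]; exact ⟨rfl, w, hy⟩
      obtain ⟨x', hx', -⟩ := h.exists_code_eq
        (hty.symm.trans (congrArg Subtype.val ht).symm) hyr
      rw [hr] at hx'
      obtain rfl : x = x' := hx'.1
      exact ⟨x, hx', (congrArg Subtype.val ht).symm⟩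
  · simp only [hfix, pFix, Set.mem_ofPred_eq]
    constructor
    · rintro ⟨_, ⟨rfl, hx⟩, ht⟩
      exact ⟨Subtype.ext ht.symm, (h.mem_codeRep_iff hc rfl).2 ⟨x, hx, rfl⟩⟩
    · rintro ⟨ht, hx⟩
      obtain ⟨y, hy, hxy⟩ := (h.mem_codeRep_iff hc rfl).1 hx
      obtain rfl := h.code_injOn hc (hrefl x) ⟨a, hy⟩ hxy
      exact ⟨x, ⟨rfl, hy⟩, (congrArg Subtype.val ht).symm⟩
  · simp [hz]
  · simp only [h.mem_e, exists_eq_left']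
    exact ⟨fun ht => Subtype.ext ht.symm, fun ht => (congrArg Subtype.val ht).symm⟩

end Codes

/-- The finite representation property for the signature
{composition, intersection, domain, range, zero, identity, fixset}. -/
theorem frp_comp_meet_dom_ran_zero_id_fix {A : Type*} [Fintype A]
    (star meet : A → A → A) (d r fix : A → A) (z e : A)
    (h : ∃ (X : Type u) (θ : A → Set (X × X)), IsRepFixZE star meet d r fix z e θ) :
    ∃ (Y : Type v) (_ : Fintype Y) (θ : A → Set (Y × Y)),
      IsRepFixZE star meet d r fix z e θ := by
  obtain ⟨X, θ, hθ⟩ := h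
  obtain ⟨n, ⟨f⟩⟩ := Finite.exists_equiv_fin (Codes θ)
  exact ⟨ULift.{v} (Fin n), inferInstance, _, hθ.isRep_codeRep.transport (Equiv.ulift.trans f.symm)⟩
end

section
/- Let A be a finite type with binary operations ⋆, ⊓ and unary operations d, r, let θ be a representation of A by partial functions on X and θ' a representation on X'. Let x ∈ X and α ∈ A with α labelling (x,x) in θ, and x' ∈ X' and β ∈ A with β labelling (x',x') in θ'. Suppose there exist a, b ∈ A with d(a) = α, r(a) = β, d(b) = β and r(b) = α. Then there is a bijection φ from the future of x (with respect to θ) to the future of x' (with respect to θ') such that for all y, z in the future of x and all c ∈ A, (y,z) ∈ θ(c) ↔ (φ(y), φ(z)) ∈ θ'(c). -/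
universe u v w

/-- Representation for the signature {composition, intersection, domain, range}. -/
def IsRepDR {A : Type*} {X : Type u} (star meet : A → A → A) (d r : A → A)
    (θ : A → Set (X × X)) : Prop :=
  Function.Injective θ ∧ (∀ a, Functional (θ a)) ∧
  (∀ a b, θ (star a b) = pComp (θ a) (θ b)) ∧
  (∀ a b, θ (meet a b) = θ a ∩ θ b) ∧
  (∀ a, θ (d a) = pDom (θ a)) ∧
  (∀ a, θ (r a) = pRan (θ a))

namespace IsRepDR

variable {A : Type*} {X : Type u} {star meet : A → A → A} {d r : A → A} {θ : A → Set (X × X)}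

theorem functional (h : IsRepDR star meet d r θ) {a : A} {x y z : X}
    (hy : (x, y) ∈ θ a) (hz : (x, z) ∈ θ a) : y = z := h.2.1 a x y z hy hz

theorem mem_star (h : IsRepDR star meet d r θ) {a b : A} {x z : X} :
    (x, z) ∈ θ (star a b) ↔ ∃ y, (x, y) ∈ θ a ∧ (y, z) ∈ θ b := by
  rw [h.2.2.1]; rfl

theorem mem_meet (h : IsRepDR star meet d r θ) {a b : A} {x y : X} :
    (x, y) ∈ θ (meet a b) ↔ (x, y) ∈ θ a ∧ (x, y) ∈ θ b := by
  rw [h.2.2.2.1]; rfl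

theorem mem_d (h : IsRepDR star meet d r θ) {a : A} {x y : X} :
    (x, y) ∈ θ (d a) ↔ x = y ∧ ∃ z, (x, z) ∈ θ a := by
  rw [h.2.2.2.2.1]; rfl

theorem mem_r (h : IsRepDR star meet d r θ) {a : A} {x y : X} :
    (x, y) ∈ θ (r a) ↔ x = y ∧ ∃ z, (z, y) ∈ θ a := by
  rw [h.2.2.2.2.2]; rfl

theorem ext (h : IsRepDR star meet d r θ) {a b : A}
    (hab : ∀ x y, (x, y) ∈ θ a ↔ (x, y) ∈ θ b) : a = b :=
  h.1 (Set.ext fun p => hab p.1 p.2)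

theorem star_assoc (h : IsRepDR star meet d r θ) (a b c : A) :
    star (star a b) c = star a (star b c) := by
  refine h.ext fun x y => ?_
  simp only [h.mem_star]
  grind

/-- In a finite representable algebra, `a` has a right inverse relative to its domain as soon as
some `b` leads back from the range of `a` onto the domain of `a`. -/
theorem exists_star_eq_d [Finite A] (h : IsRepDR star meet d r θ) {a b : A}
    (hd : d b = r a) (hr : r b = d a) : ∃ c, star a c = d a := by
  let v : ℕ → A := fun n => Nat.rec (d a) (fun _ w => star (star a b) w) n
  have v_succ (n : ℕ) : v (n + 1) = star (star a b) (v n) := rfl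
  have mem_d_of_mem (n : ℕ) (s t : X) (hst : (s, t) ∈ θ (v n)) : (s, s) ∈ θ (d a) := by
    cases n with
    | zero =>
      have hst : (s, t) ∈ θ (d a) := hst
      rw [h.mem_d] at hst ⊢
      exact ⟨rfl, hst.2⟩
    | succ n =>
      rw [v_succ, h.mem_star] at hst
      obtain ⟨_, hs, _⟩ := hst
      obtain ⟨y, hy, _⟩ := h.mem_star.1 hs
      exact h.mem_d.2 ⟨rfl, y, hy⟩
  have v_add (m n : ℕ) : v (m + n) = star (v m) (v n) := by
    induction m with
    | zero =>
      refine h.ext fun s t => ?_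
      rw [Nat.zero_add, h.mem_star]
      constructor
      · exact fun hst => ⟨s, mem_d_of_mem n s t hst, hst⟩
      · rintro ⟨u, hu, hut⟩
        obtain rfl := (h.mem_d.1 hu).1
        exact hut
    | succ m ih => rw [Nat.add_right_comm, v_succ, ih, v_succ,
      h.star_assoc (star a b) (v m)]
  have surj (n : ℕ) (s : X) (hs : (s, s) ∈ θ (d a)) : ∃ t, (t, s) ∈ θ (v n) := by
    induction n generalizing s with
    | zero => exact ⟨s, hs⟩
    | succ n ih =>
      obtain ⟨t, ht⟩ := ih s hs
      have htd := mem_d_of_mem n t s ht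
      rw [← hr, h.mem_r] at htd
      obtain ⟨-, u, hu⟩ := htd
      have hud : (u, u) ∈ θ (d b) := h.mem_d.2 ⟨rfl, t, hu⟩
      rw [hd, h.mem_r] at hud
      obtain ⟨-, w, hw⟩ := hud
      exact ⟨w, h.mem_star.2 ⟨t, h.mem_star.2 ⟨u, hw, hu⟩, ht⟩⟩
  obtain ⟨i, j, hij, hv⟩ : ∃ i j, i < j ∧ v i = v j := by
    obtain ⟨i, j, hne, hv⟩ := Finite.exists_ne_map_eq_of_infinite v
    rcases lt_or_gt_of_ne hne with hlt | hlt
    · exact ⟨i, j, hlt, hv⟩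
    · exact ⟨j, i, hlt, hv.symm⟩
  obtain ⟨k, rfl⟩ := Nat.exists_eq_add_of_lt hij
  have hk (s : X) (hs : (s, s) ∈ θ (d a)) : (s, s) ∈ θ (v (k + 1)) := by
    obtain ⟨t, ht⟩ := surj i s hs
    have ht' := ht
    rw [hv, Nat.add_assoc, v_add, h.mem_star] at ht'
    obtain ⟨u, hu, hus⟩ := ht'
    rwa [h.functional hu ht] at hus
  refine ⟨star b (v k), ?_⟩
  rw [← h.star_assoc, ← v_succ]
  refine h.ext fun s t => ⟨fun hst => ?_, fun hst => ?_⟩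
  · have hs := mem_d_of_mem (k + 1) s t hst
    rwa [← h.functional (hk s hs) hst]
  · obtain rfl := (h.mem_d.1 hst).1
    exact hk s hst

/-- A choice of the point of the future of `x'` reached by the elements leading from `x`. -/
theorem exists_future_map {X' : Type v} {θ' : A → Set (X' × X')}
    (h : IsRepDR star meet d r θ) (h' : IsRepDR star meet d r θ') {x : X} {x' : X'}
    (hdom : ∀ f, (∃ y, (x, y) ∈ θ f) ↔ ∃ y, (x', y) ∈ θ' f)
    {y : X} (hy : y ∈ future θ x) :
    ∃ y', y' ∈ future θ' x' ∧ ∀ f, (x, y) ∈ θ f ↔ (x', y') ∈ θ' f := by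
  obtain ⟨b, hb⟩ := hy
  obtain ⟨y', hy'⟩ := (hdom b).1 ⟨y, hb⟩
  refine ⟨y', ⟨b, hy'⟩, fun f => ⟨fun hf => ?_, fun hf => ?_⟩⟩
  · obtain ⟨z, hz⟩ := (hdom (meet b f)).1 ⟨y, h.mem_meet.2 ⟨hb, hf⟩⟩
    obtain ⟨hzb, hzf⟩ := h'.mem_meet.1 hz
    rwa [h'.functional hzb hy'] at hzf
  · obtain ⟨z, hz⟩ := (hdom (meet b f)).2 ⟨y', h'.mem_meet.2 ⟨hy', hf⟩⟩
    obtain ⟨hzb, hzf⟩ := h.mem_meet.1 hz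
    rwa [h.functional hzb hb] at hzf

/-- Vertices lying in the domains of the same elements have isomorphic futures. -/
theorem exists_future_iso {X' : Type v} {θ' : A → Set (X' × X')}
    (h : IsRepDR star meet d r θ) (h' : IsRepDR star meet d r θ') {x : X} {x' : X'}
    (hdom : ∀ f, (∃ y, (x, y) ∈ θ f) ↔ ∃ y, (x', y) ∈ θ' f) :
    ∃ φ : future θ x → future θ' x', Function.Bijective φ ∧
      ∀ (y z : future θ x) (c : A),
        ((y : X), (z : X)) ∈ θ c ↔ ((φ y : X'), (φ z : X')) ∈ θ' c := by
  choose φ hφ hφ_iff using fun y : future θ x => exists_future_map h h' hdom y.2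
  refine ⟨fun y => ⟨φ y, hφ y⟩, ⟨fun y z hyz => ?_, fun y' => ?_⟩, fun y z c => ?_⟩
  · obtain ⟨b, hb⟩ := y.2
    have hz : (x, (z : X)) ∈ θ b := by
      have hφ_eq : φ y = φ z := congrArg Subtype.val hyz
      rwa [hφ_iff, ← hφ_eq, ← hφ_iff]
    exact Subtype.ext (h.functional hb hz)
  · obtain ⟨y, hy, hy_iff⟩ := exists_future_map h' h (fun f => (hdom f).symm) y'.2
    obtain ⟨b, hb⟩ := y'.2
    refine ⟨⟨y, hy⟩, Subtype.ext (h'.functional ?_ hb)⟩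
    exact (hφ_iff ⟨y, hy⟩ b).1 ((hy_iff b).1 hb)
  · obtain ⟨b, hb⟩ := y.2
    have hb' := (hφ_iff y b).1 hb
    constructor
    · intro hc
      have hz := (hφ_iff z (star b c)).1 (h.mem_star.2 ⟨y, hb, hc⟩)
      obtain ⟨u, hu, huz⟩ := h'.mem_star.1 hz
      rwa [h'.functional hu hb'] at huz
    · intro hc
      have hz := (hφ_iff z (star b c)).2 (h'.mem_star.2 ⟨φ y, hb', hc⟩)
      obtain ⟨u, hu, huz⟩ := h.mem_star.1 hz
      rwa [h.functional hu hb] at huz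

theorem future_subset (h : IsRepDR star meet d r θ) {a : A} {x y : X} (hxy : (x, y) ∈ θ a) :
    future θ y ⊆ future θ x :=
  fun _ ⟨b, hb⟩ => ⟨star a b, h.mem_star.2 ⟨y, hxy, hb⟩⟩

end IsRepDR

/-- Equivalent realisable domain elements have isomorphic futures. -/
theorem equivalent_isomorphic_futures {A : Type*} [Fintype A] {X : Type u} {X' : Type v}
    (star meet : A → A → A) (d r : A → A)
    (θ : A → Set (X × X)) (θ' : A → Set (X' × X'))
    (hθ : IsRepDR star meet d r θ) (hθ' : IsRepDR star meet d r θ')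
    (x : X) (α : A) (hα : Labels meet θ α x x)
    (x' : X') (β : A) (hβ : Labels meet θ' β x' x')
    (hab : ∃ a : A, d a = α ∧ r a = β) (hba : ∃ b : A, d b = β ∧ r b = α) :
    ∃ φ : future θ x → future θ' x', Function.Bijective φ ∧
      ∀ (y z : future θ x) (c : A),
        ((y : X), (z : X)) ∈ θ c ↔ ((φ y : X'), (φ z : X')) ∈ θ' c := by
  obtain ⟨a, rfl, rfl⟩ := hab
  obtain ⟨b, hd, hr⟩ := hba
  obtain ⟨c, hc⟩ := hθ.exists_star_eq_d hd hr
  obtain ⟨-, w, hw⟩ := hθ'.mem_r.1 hβ.1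
  have hwd : (w, w) ∈ θ' (d a) := hθ'.mem_d.2 ⟨rfl, x', hw⟩
  have hxw : (x', w) ∈ θ' c := by
    rw [← hc, hθ'.mem_star] at hwd
    obtain ⟨u, hu, huw⟩ := hwd
    rwa [hθ'.functional hu hw] at huw
  have hfut : future θ' x' = future θ' w :=
    (hθ'.future_subset hw).antisymm (hθ'.future_subset hxw)
  rw [hfut]
  refine hθ.exists_future_iso hθ' fun f => ⟨fun hf => ?_, fun ⟨y, hy⟩ => ?_⟩
  · have hle := hα.2 (d f) (hθ.mem_d.2 ⟨rfl, hf⟩)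
    rw [← hle] at hwd
    exact (hθ'.mem_d.1 (hθ'.mem_meet.1 hwd).2).2
  · have hwf : (w, w) ∈ θ' (d f) := hθ'.mem_d.2 ⟨rfl, y, hy⟩
    have hle := hβ.2 (star c (star (d f) a))
      (hθ'.mem_star.2 ⟨w, hxw, hθ'.mem_star.2 ⟨w, hwf, hw⟩⟩)
    have hx := hα.1
    rw [← hc] at hx
    obtain ⟨t, ht, htx⟩ := hθ.mem_star.1 hx
    have htr : (t, t) ∈ θ (r a) := hθ.mem_r.2 ⟨rfl, x, ht⟩
    rw [← hle, hθ.mem_meet, hθ.mem_star] at htr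
    obtain ⟨-, s, hs, hst⟩ := htr
    obtain ⟨u, hu, -⟩ := hθ.mem_star.1 hst
    rw [hθ.functional hs htx, hθ.mem_d] at hu
    exact hu.2
end
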